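/- Let P : C →_A C' be an execution step and let u be a node with u ∉ A_t. Then the node set of the subtree of u is preserved: S'_u = S_u. -/

import Mathlib

open scoped Classical

/-- A pre-configuration: a finite node set `V` with a partial parent map
(`none` means the node has no parent) and an integer height assignment. -/
structure PreConfig (V : Type*) where
  parent : V → Option V
  height : V → ℤ

namespace PreConfig

variable {V : Type*} [Fintype V] [LinearOrder V]

/-- The children of `u` are the nodes whose parent is `u`. -/
noncomputable def children (C : PreConfig V) (u : V) : Finset V :=
  Finset.univ.filter (fun v => C.parent v = some u)

/-- A leaf is a node with no children. -/
def IsLeaf (C : PreConfig V) (u : V) : Prop := C.children u = ∅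

/-- Maximum height value among the children of `u` (junk value `0` for a leaf). -/
noncomputable def maxH (C : PreConfig V) (u : V) : ℤ :=
  if h : (C.children u).Nonempty then (C.children u).sup' h C.height else 0

/-- Minimum height value among the children of `u` (junk value `0` for a leaf). -/
noncomputable def minH (C : PreConfig V) (u : V) : ℤ :=
  if h : (C.children u).Nonempty then (C.children u).inf' h C.height else 0

/-- A child of `u` of maximum height value; ties broken by a fixed rule
(smallest ID). Junk value `u` for a leaf. -/
noncomputable def maxChild (C : PreConfig V) (u : V) : V :=
  if h : ((C.children u).filter fun v => C.height v = C.maxH u).Nonempty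
  then ((C.children u).filter fun v => C.height v = C.maxH u).min' h else u

/-- A child of `u` of minimum height value; ties broken by a fixed rule
(smallest ID). Junk value `u` for a leaf. -/
noncomputable def minChild (C : PreConfig V) (u : V) : V :=
  if h : ((C.children u).filter fun v => C.height v = C.minH u).Nonempty
  then ((C.children u).filter fun v => C.height v = C.minH u).min' h else u

/-- `stable(u)`: `h(u) = 0` if `u` is a leaf, and `h(u) = 1 + max_{w child of u} h(w)` otherwise. -/
def Stable (C : PreConfig V) (u : V) : Prop :=
  (C.IsLeaf u ∧ C.height u = 0) ∨ (¬ C.IsLeaf u ∧ C.height u = 1 + C.maxH u)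

/-- `balanced(u)`: `|h(z) − h(z')| ≤ α` for all children `z, z'` of `u`. -/
def Balanced (α : ℤ) (C : PreConfig V) (u : V) : Prop :=
  ∀ z ∈ C.children u, ∀ z' ∈ C.children u, |C.height z - C.height z'| ≤ α

/-- `u` is enabled for a height update iff `¬stable(u)`. -/
def UpdateEnabled (C : PreConfig V) (u : V) : Prop := ¬ C.Stable u

/-- `u` is enabled for a swap iff `stable(u) ∧ stable(max(u)) ∧ ¬balanced(u)`. -/
def SwapEnabled (α : ℤ) (C : PreConfig V) (u : V) : Prop :=
  C.Stable u ∧ C.Stable (C.maxChild u) ∧ ¬ Balanced α C u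

/-- `u` is enabled iff it is enabled for a height update or for a swap. -/
def Enabled (α : ℤ) (C : PreConfig V) (u : V) : Prop :=
  C.UpdateEnabled u ∨ SwapEnabled α C u

/-- The value written by a height update: `0` for a leaf, `1 + max_{w child of u} h(w)` otherwise. -/
noncomputable def newHeight (C : PreConfig V) (u : V) : ℤ :=
  if C.IsLeaf u then 0 else 1 + C.maxH u

/-- A bad node: an internal node `u` with `h(u) ≤ max_{v child of u} h(v)`,
or a leaf `u` with `h(u) < 0`. -/
def Bad (C : PreConfig V) (u : V) : Prop :=
  (¬ C.IsLeaf u ∧ C.height u ≤ C.maxH u) ∨ (C.IsLeaf u ∧ C.height u < 0)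

/-- `v` reaches `a` by iterating the parent map. -/
def Reaches (C : PreConfig V) (v a : V) : Prop :=
  Relation.ReflTransGen (fun x y => C.parent x = some y) v a

/-- The underlying graph is a rooted tree with root `r`: `r` has no parent,
every other node has a (unique) parent, and every node reaches `r` by
iterating the parent map. -/
def IsTree (C : PreConfig V) (r : V) : Prop :=
  C.parent r = none ∧ (∀ v, C.parent v = none → v = r) ∧ ∀ v, C.Reaches v r

/-- The subtree `S_u` of `u`: the set of descendants of `u` (including `u`). -/
def subtree (C : PreConfig V) (u : V) : Set V := {v | C.Reaches v u}

/-- The actual height `h*(u)` of `u`: the length of a longest directed path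
going downward from `u` (such a maximal path necessarily ends at a leaf of `S_u`). -/
noncomputable def hstar (C : PreConfig V) (u : V) : ℕ :=
  sSup {n : ℕ | ∃ f : ℕ → V, f 0 = u ∧ ∀ i < n, C.parent (f (i + 1)) = some (f i)}

/-- An execution step `C →_A C'`: a nonempty set `A` of nodes enabled in `C` is
activated simultaneously; each `u ∈ A` enabled for a height update sets its height
to `newHeight`; each `u ∈ A` enabled for a swap replaces the edges `(u, min(u))` and
`(max(u), max(max(u)))` by `(u, max(max(u)))` and `(max(u), min(u))` (all guards and
functions evaluated in `C`); everything else is unchanged. -/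
structure Step (α : ℤ) (C C' : PreConfig V) (A : Finset V) : Prop where
  nonempty : A.Nonempty
  all_enabled : ∀ u ∈ A, Enabled α C u
  height_update : ∀ u ∈ A, C.UpdateEnabled u → C'.height u = C.newHeight u
  height_keep : ∀ u, ¬ (u ∈ A ∧ C.UpdateEnabled u) → C'.height u = C.height u
  swap_out : ∀ u ∈ A, SwapEnabled α C u → C'.parent (C.minChild u) = some (C.maxChild u)
  swap_in : ∀ u ∈ A, SwapEnabled α C u → C'.parent (C.maxChild (C.maxChild u)) = some u
  parent_keep : ∀ v, (∀ u ∈ A, SwapEnabled α C u →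
      v ≠ C.minChild u ∧ v ≠ C.maxChild (C.maxChild u)) → C'.parent v = C.parent v

end PreConfig

namespace PreConfig

variable {V : Type*} [Fintype V] [LinearOrder V]

theorem mem_children {C : PreConfig V} {u v : V} : v ∈ C.children u ↔ C.parent v = some u := by
  simp [children]

theorem maxChild_spec {C : PreConfig V} {u : V} (h : (C.children u).Nonempty) :
    C.parent (C.maxChild u) = some u ∧ C.height (C.maxChild u) = C.maxH u := by
  have hne : ((C.children u).filter fun v => C.height v = C.maxH u).Nonempty := by
    obtain ⟨v, hv, hmax⟩ := Finset.exists_mem_eq_sup' h C.height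
    exact ⟨v, Finset.mem_filter.2 ⟨hv, by rw [maxH, dif_pos h, hmax]⟩⟩
  have hmem := Finset.min'_mem _ hne
  rw [maxChild, dif_pos hne]
  rwa [Finset.mem_filter, mem_children] at hmem

theorem minChild_spec {C : PreConfig V} {u : V} (h : (C.children u).Nonempty) :
    C.parent (C.minChild u) = some u ∧ C.height (C.minChild u) = C.minH u := by
  have hne : ((C.children u).filter fun v => C.height v = C.minH u).Nonempty := by
    obtain ⟨v, hv, hmin⟩ := Finset.exists_mem_eq_inf' h C.height
    exact ⟨v, Finset.mem_filter.2 ⟨hv, by rw [minH, dif_pos h, hmin]⟩⟩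
  have hmem := Finset.min'_mem _ hne
  rw [minChild, dif_pos hne]
  rwa [Finset.mem_filter, mem_children] at hmem

theorem maxChild_eq_self_or_parent_eq (C : PreConfig V) (u : V) :
    C.maxChild u = u ∨ C.parent (C.maxChild u) = some u := by
  by_cases h : (C.children u).Nonempty
  · exact Or.inr (maxChild_spec h).1
  · left
    rw [maxChild, dif_neg fun hne => h (hne.mono (Finset.filter_subset _ _))]

theorem height_le_maxH {C : PreConfig V} {u v : V} (hv : v ∈ C.children u) :
    C.height v ≤ C.maxH u := by
  rw [maxH, dif_pos ⟨v, hv⟩]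
  exact Finset.le_sup' C.height hv

theorem minH_le_height {C : PreConfig V} {u v : V} (hv : v ∈ C.children u) :
    C.minH u ≤ C.height v := by
  rw [minH, dif_pos ⟨v, hv⟩]
  exact Finset.inf'_le C.height hv

theorem children_nonempty_of_not_balanced {α : ℤ} {C : PreConfig V} {u : V}
    (h : ¬ Balanced α C u) : (C.children u).Nonempty := by
  by_contra hne
  exact h fun z hz => (hne ⟨z, hz⟩).elim

theorem maxChild_ne_minChild {α : ℤ} (hα : 0 ≤ α) {C : PreConfig V} {u : V}
    (h : ¬ Balanced α C u) : C.maxChild u ≠ C.minChild u := by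
  intro heq
  have hne := children_nonempty_of_not_balanced h
  have hH : C.maxH u = C.minH u := by
    rw [← (maxChild_spec hne).2, heq, (minChild_spec hne).2]
  refine h fun z hz z' hz' => ?_
  have h1 := height_le_maxH hz
  have h2 := minH_le_height hz
  have h3 := height_le_maxH hz'
  have h4 := minH_le_height hz'
  rw [abs_le]
  constructor <;> omega

theorem SwapEnabled.parent_maxChild {α : ℤ} {C : PreConfig V} {s : V} (h : SwapEnabled α C s) :
    C.parent (C.maxChild s) = some s :=
  (maxChild_spec (children_nonempty_of_not_balanced h.2.2)).1

theorem SwapEnabled.parent_minChild {α : ℤ} {C : PreConfig V} {s : V} (h : SwapEnabled α C s) :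
    C.parent (C.minChild s) = some s :=
  (minChild_spec (children_nonempty_of_not_balanced h.2.2)).1

/-- The three ways in which the parent of a node evolves during a step. -/
theorem Step.parent_cases {α : ℤ} {C C' : PreConfig V} {A : Finset V} (h : Step α C C' A) (v : V) :
    C'.parent v = C.parent v ∨
      (∃ s ∈ A, SwapEnabled α C s ∧ v = C.minChild s ∧ C'.parent v = some (C.maxChild s)) ∨
      ∃ s ∈ A, SwapEnabled α C s ∧ v = C.maxChild (C.maxChild s) ∧ C'.parent v = some s := by
  by_cases hv : ∀ s ∈ A, SwapEnabled α C s → v ≠ C.minChild s ∧ v ≠ C.maxChild (C.maxChild s)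
  · exact Or.inl (h.parent_keep v hv)
  · push Not at hv
    obtain ⟨s, hs, hsw, hv⟩ := hv
    by_cases hmin : v = C.minChild s
    · exact Or.inr (Or.inl ⟨s, hs, hsw, hmin, hmin ▸ h.swap_out s hs hsw⟩)
    · have hmax := hv hmin
      exact Or.inr (Or.inr ⟨s, hs, hsw, hmax, hmax ▸ h.swap_in s hs hsw⟩)

/-- After a step, the target of a swap of `s` hangs below `s`, or below the parent of `s` when `s`
is itself the target of a swap. -/
theorem Step.parent_maxChild {α : ℤ} (hα : 0 ≤ α) {C C' : PreConfig V} {A : Finset V}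
    (h : Step α C C' A) {s : V} (hsw : SwapEnabled α C s) :
    C'.parent (C.maxChild s) = some s ∨
      ∃ t ∈ A, SwapEnabled α C t ∧ s = C.maxChild t ∧ C'.parent (C.maxChild s) = some t := by
  have hs := hsw.parent_maxChild
  rcases h.parent_cases (C.maxChild s) with hk | ⟨t, -, htw, hv, -⟩ | ⟨t, htA, htw, hv, hp⟩
  · exact Or.inl (hk.trans hs)
  · have hts : t = s := Option.some.inj (by rw [← htw.parent_minChild, ← hv, hs])
    subst hts
    exact (maxChild_ne_minChild hα htw.2.2 hv).elim
  · rcases maxChild_eq_self_or_parent_eq C (C.maxChild t) with hself | hpar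
    · have hts : t = s := Option.some.inj (by rw [← htw.parent_maxChild, ← hself, ← hv, hs])
      exact Or.inl (hts ▸ hp)
    · exact Or.inr ⟨t, htA, htw, Option.some.inj (by rw [← hpar, ← hv, hs]), hp⟩

theorem Step.subtree_subset {α : ℤ} {C C' : PreConfig V} {A : Finset V} (h : Step α C C' A) {u : V}
    (hu : ¬ ∃ s ∈ A, SwapEnabled α C s ∧ u = C.maxChild s) : C'.subtree u ⊆ C.subtree u := by
  intro v hv
  change C.Reaches v u
  induction hv using Relation.ReflTransGen.head_induction_on with
  | refl => exact .refl
  | @head v p hvp _ ih =>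
    rcases h.parent_cases v with hk | ⟨s, hs, hsw, rfl, hp⟩ | ⟨s, hs, hsw, rfl, hp⟩
    · exact .head (hk ▸ hvp) ih
    · obtain rfl : p = C.maxChild s := Option.some.inj (hvp.symm.trans hp)
      rcases ih.cases_head with heq | ⟨q, hq, hqu⟩
      · exact (hu ⟨s, hs, hsw, heq.symm⟩).elim
      · obtain rfl : q = s := Option.some.inj (hq.symm.trans hsw.parent_maxChild)
        exact .head hsw.parent_minChild hqu
    · obtain rfl : p = s := Option.some.inj (hvp.symm.trans hp)
      have hm : C.Reaches (C.maxChild p) u := .head hsw.parent_maxChild ih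
      rcases maxChild_eq_self_or_parent_eq C (C.maxChild p) with hself | hpar
      · rwa [hself]
      · exact .head hpar hm

theorem Step.subset_subtree {α : ℤ} (hα : 0 ≤ α) {C C' : PreConfig V} {A : Finset V}
    (h : Step α C C' A) {u : V} (hu : ¬ ∃ s ∈ A, SwapEnabled α C s ∧ u = C.maxChild s) :
    C.subtree u ⊆ C'.subtree u := by
  intro v hv
  suffices C'.Reaches v u ∧ (v ≠ u → ∀ p, C.parent v = some p → C'.Reaches p u) from this.1
  induction hv using Relation.ReflTransGen.head_induction_on with
  | refl => exact ⟨.refl, fun hne => (hne rfl).elim⟩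
  | @head v p hvp _ ih =>
    obtain ⟨hpu, hgrand⟩ := ih
    have target_above : ∀ t ∈ A, SwapEnabled α C t → p = C.maxChild t → C'.Reaches t u := by
      rintro t ht htw rfl
      exact hgrand (fun heq => hu ⟨t, ht, htw, heq.symm⟩) t htw.parent_maxChild
    refine ⟨?_, fun _ q hq => Option.some.inj (hvp.symm.trans hq) ▸ hpu⟩
    rcases h.parent_cases v with hk | ⟨s, hs, hsw, rfl, hp⟩ | ⟨s, hs, hsw, rfl, hp⟩
    · exact .head (hk.trans hvp) hpu
    · obtain rfl : p = s := Option.some.inj (hvp.symm.trans hsw.parent_minChild)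
      refine .head hp ?_
      rcases h.parent_maxChild hα hsw with hm | ⟨t, ht, htw, hpt, hm⟩
      · exact .head hm hpu
      · exact .head hm (target_above t ht htw hpt)
    · refine .head hp ?_
      rcases maxChild_eq_self_or_parent_eq C (C.maxChild s) with hself | hpar
      · rw [hself, hsw.parent_maxChild] at hvp
        exact Option.some.inj hvp ▸ hpu
      · exact target_above s hs hsw (Option.some.inj (hvp.symm.trans hpar))

end PreConfig

/-- Let `C →_A C'` be an execution step and `u` a node with `u ∉ A_t`
(`u` is not the target `max(s)` of any swap performed by a node `s`). Then the node
set of the subtree of `u` is preserved: `S'_u = S_u`. -/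
theorem stmt17 {V : Type*} [Fintype V] [LinearOrder V] (α : ℤ) (hα : 1 ≤ α)
    (C C' : PreConfig V) (A : Finset V) (r : V)
    (hT : C.IsTree r) (hstep : PreConfig.Step α C C' A)
    (u : V) (hu : ¬ ∃ s ∈ A, PreConfig.SwapEnabled α C s ∧ u = C.maxChild s) :
    C'.subtree u = C.subtree u := by
  have hα' : 0 ≤ α := by omega
  exact (hstep.subtree_subset hu).antisymm (hstep.subset_subtree hα' hu)
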